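/- Let α ∈ (1,2) and n ≥ 2 an integer, and let t_k = t^{(α)}_k for k = 0,…,n−1 be the entries of the first column of G_n^{(α)}. Then t_0 > 0; t_1 < t_2 < ⋯ < t_{n−1} < 0; and t_0 + 2·Σ_{j=1}^{n−1} t_j > 0. -/

import Mathlib

/-- Grünwald–Letnikov coefficients: `g 0 = 1`, `g k = (1 - (α+1)/k) * g (k-1)` for `k ≥ 1`. -/
noncomputable def glCoef (α : ℝ) : ℕ → ℝ
  | 0 => 1
  | k + 1 => (1 - (α + 1) / ((k : ℝ) + 1)) * glCoef α k

/-- First-column entries of `G_n^{(α)}`: `t_0 = -2g_1`, `t_1 = -(g_0+g_2)`, `t_k = -g_{k+1}` for `k ≥ 2`. -/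
noncomputable def tC (α : ℝ) : ℕ → ℝ
  | 0 => -2 * glCoef α 1
  | 1 => -(glCoef α 0 + glCoef α 2)
  | k + 2 => -glCoef α (k + 3)

/-- Padded coefficients: `t_k` for `k < n`, `0` for `k ≥ n`. -/
noncomputable def tpad (n : ℕ) (t : ℕ → ℝ) (k : ℕ) : ℝ := if k < n then t k else 0

/-- The `n×n` symmetric Toeplitz matrix with `(i,j)` entry `t_{|i-j|}`. -/
noncomputable def toeplitzM (n : ℕ) (t : ℕ → ℝ) : Matrix (Fin n) (Fin n) ℝ :=
  fun i j => t (Nat.dist i.val j.val)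

/-- The Hankel matrix `(H_n)_{ij} = t_{i+j} + t_{2(n+1)-(i+j)}` (1-based indices,
with the convention `t_k = 0` for `k ≥ n`). Here `i j : Fin n` are 0-based. -/
noncomputable def hankelM (n : ℕ) (t : ℕ → ℝ) : Matrix (Fin n) (Fin n) ℝ :=
  fun i j => tpad n t (i.val + j.val + 2) + tpad n t (2 * n - (i.val + j.val))

/-- The τ-matrix `τ(T_n) = T_n - H_n`. -/
noncomputable def tauM (n : ℕ) (t : ℕ → ℝ) : Matrix (Fin n) (Fin n) ℝ :=
  toeplitzM n t - hankelM n t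

/-- The matrix `G_n^{(α)}`. -/
noncomputable def Gmat (α : ℝ) (n : ℕ) : Matrix (Fin n) (Fin n) ℝ := toeplitzM n (tC α)

theorem glCoef_succ (α : ℝ) (k : ℕ) :
    glCoef α (k + 1) = (1 - (α + 1) / ((k : ℝ) + 1)) * glCoef α k := rfl

theorem succ_mul_glCoef_succ (α : ℝ) (k : ℕ) :
    ((k : ℝ) + 1) * glCoef α (k + 1) = ((k : ℝ) - α) * glCoef α k := by
  rw [glCoef_succ]
  field_simp
  ring

theorem glCoef_one (α : ℝ) : glCoef α 1 = -α := by
  simp [glCoef]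

theorem glCoef_two (α : ℝ) : glCoef α 2 = α * (α - 1) / 2 := by
  rw [glCoef_succ, glCoef_one]
  push_cast
  ring

theorem glCoef_pos {α : ℝ} (hα : α ∈ Set.Ioo (1 : ℝ) 2) (k : ℕ) : 0 < glCoef α (k + 2) := by
  obtain ⟨h1, h2⟩ := hα
  induction k with
  | zero =>
    rw [glCoef_two]
    have : 0 < α - 1 := by linarith
    positivity
  | succ k ih =>
    have h := succ_mul_glCoef_succ α (k + 2)
    push_cast at h
    have hk : (0 : ℝ) < k + 2 - α := by linarith [k.cast_nonneg (α := ℝ)]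
    have hpos := h ▸ mul_pos hk ih
    exact pos_of_mul_pos_right hpos (by positivity)

theorem glCoef_succ_lt {α : ℝ} (hα : α ∈ Set.Ioo (1 : ℝ) 2) (k : ℕ) :
    glCoef α (k + 3) < glCoef α (k + 2) := by
  rw [glCoef_succ α (k + 2)]
  have hlt : 0 < (α + 1) / (((k + 2 : ℕ) : ℝ) + 1) := by
    have := hα.1
    positivity
  nlinarith [mul_pos hlt (glCoef_pos hα k)]

theorem mul_tC_zero_add_two_mul_sum (α : ℝ) (m : ℕ) :
    α * (tC α 0 + 2 * ∑ j ∈ Finset.Ico 1 (m + 2), tC α j) =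
      2 * ((m : ℝ) + 3) * glCoef α (m + 3) := by
  induction m with
  | zero =>
    have h := succ_mul_glCoef_succ α 2
    simp only [zero_add, Nat.Ico_succ_singleton, Finset.sum_singleton, tC, glCoef_one,
      glCoef_two, glCoef.eq_1] at h ⊢
    push_cast at h ⊢
    linarith
  | succ m ih =>
    have h := succ_mul_glCoef_succ α (m + 3)
    rw [Finset.sum_Ico_succ_top (by omega : 1 ≤ m + 2), tC.eq_3]
    push_cast at h ⊢
    linear_combination ih - 2 * h

theorem tC_properties (α : ℝ) (hα : α ∈ Set.Ioo (1 : ℝ) 2) (n : ℕ) (hn : 2 ≤ n) :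
    0 < tC α 0 ∧
    (∀ k : ℕ, 1 ≤ k → k + 1 ≤ n - 1 → tC α k < tC α (k + 1)) ∧
    tC α (n - 1) < 0 ∧
    0 < tC α 0 + 2 * ∑ j ∈ Finset.Ico 1 n, tC α j := by
  have hα0 : 0 < α := by linarith [hα.1]
  obtain ⟨m, rfl⟩ := Nat.exists_eq_add_of_le' hn
  refine ⟨?_, ?_, ?_, ?_⟩
  · rw [tC.eq_1, glCoef_one]
    linarith
  · rintro (_ | _ | k) hk -
    · omega
    · simp only [zero_add, tC, glCoef.eq_1]
      linarith [glCoef_succ_lt hα 0]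
    · exact neg_lt_neg (glCoef_succ_lt hα (k + 1))
  · rcases m with _ | k
    · simp only [zero_add, Nat.add_one_sub_one, tC, glCoef.eq_1]
      linarith [glCoef_pos hα 0]
    · exact neg_neg_of_pos (glCoef_pos hα (k + 1))
  · refine pos_of_mul_pos_right ?_ hα0.le
    rw [mul_tC_zero_add_two_mul_sum]
    have := glCoef_pos hα (m + 1)
    positivity
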